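/- Let M_EL be an EL model and M_AK^α its induced AK model. Then for every EL formula φ, every world w of M_EL, and every agent i, M_EL, w ⊨ φ if and only if M_AK^α, (i, w) ⊨ T(φ). -/

import Mathlib

/- Agent-knowledge (AK) logic: language -/
inductive AKForm (PA PK NA NK : Type) : Type
  | propA : PA → AKForm PA PK NA NK
  | propK : PK → AKForm PA PK NA NK
  | nomA  : NA → AKForm PA PK NA NK
  | nomK  : NK → AKForm PA PK NA NK
  | neg   : AKForm PA PK NA NK → AKForm PA PK NA NK
  | and   : AKForm PA PK NA NK → AKForm PA PK NA NK → AKForm PA PK NA NK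
  | boxA  : AKForm PA PK NA NK → AKForm PA PK NA NK
  | boxK  : AKForm PA PK NA NK → AKForm PA PK NA NK
  | atA   : NA → AKForm PA PK NA NK → AKForm PA PK NA NK
  | atK   : NK → AKForm PA PK NA NK → AKForm PA PK NA NK

/- AK models: nominals denote single points (singleton valuations) -/
structure AKModel (PA PK NA NK : Type) where
  WA : Type
  WK : Type
  neWA : Nonempty WA
  neWK : Nonempty WK
  R : WK → WA → WA → Prop
  S : WA → WK → WK → Prop
  VA : PA → Set WA
  VK : PK → Set WK
  nA : NA → WA
  nK : NK → WK

def AKSat {PA PK NA NK : Type} (M : AKModel PA PK NA NK) :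
    M.WA → M.WK → AKForm PA PK NA NK → Prop
  | x, _, .propA p => x ∈ M.VA p
  | _, y, .propK p => y ∈ M.VK p
  | x, _, .nomA a => x = M.nA a
  | _, y, .nomK k => y = M.nK k
  | x, y, .neg φ => ¬ AKSat M x y φ
  | x, y, .and φ ψ => AKSat M x y φ ∧ AKSat M x y ψ
  | x, y, .boxA φ => ∀ x', M.R y x x' → AKSat M x' y φ
  | x, y, .boxK φ => ∀ y', M.S x y y' → AKSat M x y' φ
  | x, y, .atA a φ => AKSat M (M.nA a) y φ
  | x, y, .atK k φ => AKSat M x (M.nK k) φ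

def AKValid {PA PK NA NK : Type} (φ : AKForm PA PK NA NK) : Prop :=
  ∀ (M : AKModel PA PK NA NK) (x : M.WA) (y : M.WK), AKSat M x y φ

/- Epistemic logic (EL): language -/
inductive ELForm (P A : Type) : Type
  | atom : P → ELForm P A
  | neg  : ELForm P A → ELForm P A
  | and  : ELForm P A → ELForm P A → ELForm P A
  | know : A → ELForm P A → ELForm P A

structure ELModel (P A : Type) where
  W : Type
  neW : Nonempty W
  R : A → W → W → Prop
  V : P → Set W

def ELSat {P A : Type} (M : ELModel P A) : M.W → ELForm P A → Prop
  | w, .atom p => w ∈ M.V p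
  | w, .neg φ => ¬ ELSat M w φ
  | w, .and φ ψ => ELSat M w φ ∧ ELSat M w ψ
  | w, .know i φ => ∀ v, M.R i w v → ELSat M v φ

def ELValid {P A : Type} (φ : ELForm P A) : Prop :=
  ∀ (M : ELModel P A) (w : M.W), ELSat M w φ

/- The translation T, determined by bijections Prop ≃ Prop_K and A ≃ Nom_A -/
def Tr {P A PA PK NA NK : Type} (tP : P ≃ PK) (tA : A ≃ NA) :
    ELForm P A → AKForm PA PK NA NK
  | .atom p => .propK (tP p)
  | .neg φ => .neg (Tr tP tA φ)
  | .and φ ψ => .and (Tr tP tA φ) (Tr tP tA ψ)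
  | .know i φ => .atA (tA i) (.boxK (Tr tP tA φ))

/- The induced AK model M_AK^α of an EL model (with fixed y₀ ∈ W):
   W_A = A, W_K = W, R_y = ∅, S_i = R_i, V^α(p_A) = ∅, V^α(p_K) = V(T⁻¹(p_K)),
   V^α(a) = {T⁻¹(a)}, V^α(k) = {y₀}. -/
def alphaModel {P A PA PK NA NK : Type} [Nonempty A] (tP : P ≃ PK) (tA : A ≃ NA)
    (M : ELModel P A) (y0 : M.W) : AKModel PA PK NA NK where
  WA := A
  WK := M.W
  neWA := inferInstance
  neWK := M.neW
  R := fun _ _ _ => False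
  S := fun i => M.R i
  VA := fun _ => ∅
  VK := fun q => M.V (tP.symm q)
  nA := fun a => tA.symm a
  nK := fun _ => y0

/-- For every EL formula φ, world w and agent i,
    M_EL, w ⊨ φ iff M_AK^α, (i, w) ⊨ T(φ). -/
theorem el_sat_iff_alpha_sat
    {P A PA PK NA NK : Type} [Nonempty A]
    (tP : P ≃ PK) (tA : A ≃ NA) (M : ELModel P A) (y0 : M.W)
    (φ : ELForm P A) (w : M.W) (i : A) :
    ELSat M w φ ↔
      AKSat (alphaModel (PA := PA) (NK := NK) tP tA M y0) i w (Tr tP tA φ) := by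
  induction φ generalizing w i with
  | atom p => simp [ELSat, Tr, AKSat, alphaModel]
  | neg φ ih => exact not_congr (ih w i)
  | and φ ψ ihφ ihψ => exact and_congr (ihφ w i) (ihψ w i)
  | know j φ ih =>
    simp only [ELSat, Tr, AKSat, alphaModel, Equiv.symm_apply_apply]
    exact forall₂_congr fun v _ => ih v j
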